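/- arXiv:1012.1699 — 4 statements merged into one kernel-verified Lean document; each statement's English description precedes it below -/
import Mathlib

section
/- Let X be a set with at least two points, and let d and d' be two metrics on X such that for every triple of points x, y, z ∈ X the vectors (d(x,y), d(x,z), d(y,z)) and (d'(x,y), d'(x,z), d'(y,z)) in ℝ³ are proportional (i.e. equal as points of the projective plane whenever nonzero). Then there exists λ > 0 such that d'(x,y) = λ·d(x,y) for all x, y ∈ X. -/
/-- Lemma 2.1 of the paper.  Let `X` be a set with at least two points,
and let `d`, `d'` be two metrics on `X` such that for every triple of points
`x, y, z ∈ X` the vectors `(d(x,y), d(x,z), d(y,z))` and `(d'(x,y), d'(x,z), d'(y,z))`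
in `ℝ³` are proportional.  Then there is `λ > 0` with `d' = λ·d`. -/
theorem stmt_0 {X : Type*} (htwo : ∃ a b : X, a ≠ b)
    (d d' : X → X → ℝ)
    (hd_symm : ∀ x y, d x y = d y x) (hd_self : ∀ x, d x x = 0)
    (hd_pos : ∀ x y, x ≠ y → 0 < d x y)
    (hd_tri : ∀ x y z, d x z ≤ d x y + d y z)
    (hd'_symm : ∀ x y, d' x y = d' y x) (hd'_self : ∀ x, d' x x = 0)
    (hd'_pos : ∀ x y, x ≠ y → 0 < d' x y)
    (hd'_tri : ∀ x y z, d' x z ≤ d' x y + d' y z)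
    (hprop : ∀ x y z : X, ∃ lam : ℝ,
      d' x y = lam * d x y ∧ d' x z = lam * d x z ∧ d' y z = lam * d y z) :
    ∃ lam : ℝ, 0 < lam ∧ ∀ x y : X, d' x y = lam * d x y := by
  obtain ⟨a, b, hab⟩ := htwo
  have eq_of_pair : ∀ {p q : X} {l m : ℝ}, p ≠ q → d' p q = l * d p q → d' p q = m * d p q →
      l = m := fun hpq hl hm ↦ mul_right_cancel₀ (hd_pos _ _ hpq).ne' (hl.symm.trans hm)
  have hlam : d' a b = d' a b / d a b * d a b := (div_mul_cancel₀ _ (hd_pos a b hab).ne').symm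
  have hbase : ∀ y, d' a y = d' a b / d a b * d a y := fun y ↦ by
    obtain ⟨m, h₁, h₂, -⟩ := hprop a b y
    rwa [eq_of_pair hab hlam h₁]
  refine ⟨d' a b / d a b, div_pos (hd'_pos a b hab) (hd_pos a b hab), fun x y ↦ ?_⟩
  obtain rfl | hax := eq_or_ne a x
  · exact hbase y
  · obtain ⟨m, h₁, -, h₃⟩ := hprop a x y
    rwa [eq_of_pair hax (hbase x) h₁]
end

section
/- A Möbius structure 𝓜 on a set X is Ptolemy — i.e. for every admissible quadruple the three entries of its cross-ratio triple satisfy the triangle inequality — if and only if for every z ∈ X there exists a metric d_z ∈ 𝓜 whose infinitely remote point is z. -/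
open scoped ENNReal

namespace Mobius

/-- An extended metric on `X`, allowed to have (at most) one infinitely remote point,
which is recorded in the field `rem`.  Distances take values in `ℝ≥0∞`, and the value `⊤`
occurs exactly on pairs of distinct points one of which is the remote point. -/
structure ExtMetric (X : Type*) where
  d : X → X → ℝ≥0∞
  rem : Option X
  symm : ∀ x y, d x y = d y x
  d_self : ∀ x, d x x = 0
  pos : ∀ x y, x ≠ y → 0 < d x y
  triangle : ∀ x y z, d x z ≤ d x y + d y z
  d_eq_top_iff : ∀ x y, d x y = ⊤ ↔ (x ≠ y ∧ (rem = some x ∨ rem = some y))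

/-- The finite factor of a distance used in cross-ratio triples: infinite factors are
dropped (replaced by `1`), in accordance with the standard conventions for cross-ratio
triples of quadruples containing the infinitely remote point. -/
noncomputable def ExtMetric.fd {X : Type*} (d : ExtMetric X) (x y : X) : ℝ :=
  if d.d x y = ⊤ then 1 else (d.d x y).toReal

/-- A representative in `ℝ³` of the cross-ratio triple
`crt(x,y,z,u) = (d(x,y)d(z,u) : d(x,z)d(y,u) : d(x,u)d(y,z)) ∈ ℝP²`,
with the standard conventions when the infinitely remote point occurs among the points. -/
noncomputable def crtVec {X : Type*} (d : ExtMetric X) (x y z u : X) : ℝ × ℝ × ℝ :=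
  (d.fd x y * d.fd z u, d.fd x z * d.fd y u, d.fd x u * d.fd y z)

/-- A quadruple is admissible if no entry occurs three or four times in it. -/
def Admissible {X : Type*} (x y z u : X) : Prop :=
  ¬(x = y ∧ y = z) ∧ ¬(x = y ∧ y = u) ∧ ¬(x = z ∧ z = u) ∧ ¬(y = z ∧ z = u)

/-- Two vectors in `ℝ³` represent the same point of the projective plane (they are
positively proportional). -/
def ProjEq (v w : ℝ × ℝ × ℝ) : Prop :=
  ∃ lam : ℝ, 0 < lam ∧ w = lam • v

theorem ProjEq.refl (v : ℝ × ℝ × ℝ) : ProjEq v v :=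
  ⟨1, one_pos, (one_smul ℝ v).symm⟩

theorem ProjEq.symm {v w : ℝ × ℝ × ℝ} (h : ProjEq v w) : ProjEq w v := by
  obtain ⟨l, hl, rfl⟩ := h
  exact ⟨l⁻¹, inv_pos.mpr hl, by rw [smul_smul, inv_mul_cancel₀ hl.ne', one_smul]⟩

theorem ProjEq.trans' {v w u : ℝ × ℝ × ℝ} (h1 : ProjEq v w) (h2 : ProjEq v u) :
    ProjEq w u := by
  obtain ⟨l, hl, rfl⟩ := h1
  obtain ⟨m, hm, rfl⟩ := h2
  refine ⟨m * l⁻¹, by positivity, ?_⟩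
  rw [smul_smul, mul_assoc, inv_mul_cancel₀ hl.ne', mul_one]

/-- A Möbius structure on a set `X`: a (maximal) class of pairwise Möbius-equivalent
extended metrics on `X`, i.e. metrics defining the same cross-ratio triples on all
admissible quadruples. -/
structure MobiusStructure (X : Type*) where
  M : Set (ExtMetric X)
  nonempty : M.Nonempty
  compat : ∀ d ∈ M, ∀ d' ∈ M, ∀ x y z u : X, Admissible x y z u →
    ProjEq (crtVec d x y z u) (crtVec d' x y z u)
  maximal : ∀ d' : ExtMetric X,
    (∀ d ∈ M, ∀ x y z u : X, Admissible x y z u →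
      ProjEq (crtVec d x y z u) (crtVec d' x y z u)) → d' ∈ M

/-- The Möbius structure generated by a single extended metric. -/
def MobiusStructure.ofMetric {X : Type*} (d₀ : ExtMetric X) : MobiusStructure X where
  M := {d | ∀ x y z u : X, Admissible x y z u →
    ProjEq (crtVec d₀ x y z u) (crtVec d x y z u)}
  nonempty := ⟨d₀, fun _ _ _ _ _ => ProjEq.refl _⟩
  compat := fun _ hd _ hd' x y z u ha => (hd x y z u ha).trans' (hd' x y z u ha)
  maximal := fun _ h => h d₀ (fun _ _ _ _ _ => ProjEq.refl _)

/-- A Möbius structure is Ptolemy if the entries of every cross-ratio triple of every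
admissible quadruple satisfy the triangle inequality. -/
def IsPtolemyStructure {X : Type*} (S : MobiusStructure X) : Prop :=
  ∀ d ∈ S.M, ∀ x y z u : X, Admissible x y z u →
    (crtVec d x y z u).1 ≤ (crtVec d x y z u).2.1 + (crtVec d x y z u).2.2 ∧
    (crtVec d x y z u).2.1 ≤ (crtVec d x y z u).1 + (crtVec d x y z u).2.2 ∧
    (crtVec d x y z u).2.2 ≤ (crtVec d x y z u).1 + (crtVec d x y z u).2.1

/-- The topology of a Möbius space: generated by the open balls of the metrics of the
structure (centered at points distinct from the respective remote points) together with
the complements of the closed balls. -/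
def mobiusTop {X : Type*} (S : MobiusStructure X) : TopologicalSpace X :=
  TopologicalSpace.generateFrom
    {s | ∃ d ∈ S.M, ∃ x : X, d.rem ≠ some x ∧ ∃ r : ℝ≥0∞, 0 < r ∧ r ≠ ⊤ ∧
      (s = {y | d.d y x < r} ∨ s = {y | r < d.d y x})}

/-- Connected components of subsets with respect to the Möbius topology. -/
def mobiusCCIn {X : Type*} (S : MobiusStructure X) (F : Set X) (x : X) : Set X :=
  @connectedComponentIn X (mobiusTop S) F x

/-- The pair `(x,z)` separates the pair `(y,u)` in `σ`:  `y` and `u` lie in different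
connected components of `σ \ {x,z}`. -/
def SeparatesIn {X : Type*} (S : MobiusStructure X) (σ : Set X) (x z y u : X) : Prop :=
  u ∉ mobiusCCIn S (σ \ {x, z}) y

/-- `σ` is homeomorphic to the circle `S¹` (with respect to the Möbius topology). -/
def HomeoToCircle {X : Type*} (S : MobiusStructure X) (σ : Set X) : Prop :=
  letI : TopologicalSpace X := mobiusTop S
  Nonempty (σ ≃ₜ Metric.sphere (0 : ℂ) 1)

/-- `X` is homeomorphic to the sphere `Sⁿ ⊆ ℝ^{n+1}` (w.r.t. the Möbius topology). -/
def HomeoToSphere {X : Type*} (S : MobiusStructure X) (n : ℕ) : Prop :=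
  letI : TopologicalSpace X := mobiusTop S
  Nonempty (X ≃ₜ Metric.sphere (0 : EuclideanSpace ℝ (Fin (n + 1))) 1)

/-- The subset `A ⊆ X` is homeomorphic to `ℝᵖ` (w.r.t. the Möbius topology). -/
def SubsetHomeoToEuclidean {X : Type*} (S : MobiusStructure X) (A : Set X) (p : ℕ) : Prop :=
  letI : TopologicalSpace X := mobiusTop S
  Nonempty (A ≃ₜ EuclideanSpace ℝ (Fin p))

/-- The subset `A ⊆ X` is homeomorphic to `ℝ` (w.r.t. the Möbius topology). -/
def SubsetHomeoToReal {X : Type*} (S : MobiusStructure X) (A : Set X) : Prop :=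
  letI : TopologicalSpace X := mobiusTop S
  Nonempty (A ≃ₜ ℝ)

/-- A Ptolemy circle: a subset homeomorphic to `S¹` on which the Ptolemy equality holds
for every quadruple of distinct points `(x,y,z,u)` such that `(x,z)` separates `(y,u)`. -/
def IsPtolemyCircle {X : Type*} (S : MobiusStructure X) (σ : Set X) : Prop :=
  HomeoToCircle S σ ∧
  ∀ d ∈ S.M, ∀ x ∈ σ, ∀ y ∈ σ, ∀ z ∈ σ, ∀ u ∈ σ,
    x ≠ y → x ≠ z → x ≠ u → y ≠ z → y ≠ u → z ≠ u →
    SeparatesIn S σ x z y u →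
    d.d x z * d.d y u = d.d x y * d.d z u + d.d x u * d.d y z

/-- A Möbius automorphism of `X`: a bijection preserving all cross-ratio triples. -/
def IsMobiusAuto {X : Type*} (S : MobiusStructure X) (f : X → X) : Prop :=
  Function.Bijective f ∧ ∀ d ∈ S.M, ∀ x y z u : X, Admissible x y z u →
    ProjEq (crtVec d x y z u) (crtVec d (f x) (f y) (f z) (f u))

/-- A metric sphere between two distinct points `ω`, `ω'`. -/
def IsMetricSphere {X : Type*} (S : MobiusStructure X) (ω ω' : X) (Sp : Set X) : Prop :=
  ∃ d ∈ S.M, d.rem = some ω' ∧ ∃ r : ℝ≥0∞, 0 < r ∧ r ≠ ⊤ ∧ Sp = {x | d.d x ω = r}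

/-- A space inversion with respect to `ω`, `ω'` and a metric sphere `Sp` between them. -/
def IsSpaceInversion {X : Type*} (S : MobiusStructure X) (ω ω' : X) (Sp : Set X)
    (φ : X → X) : Prop :=
  IsMobiusAuto S φ ∧ Function.Involutive φ ∧ (∀ x, φ x ≠ x) ∧ φ ω = ω' ∧
  φ '' Sp = Sp ∧ ∀ σ : Set X, IsPtolemyCircle S σ → ω ∈ σ → ω' ∈ σ → φ '' σ = σ

/-- Property (E): existence of at least one Ptolemy circle. -/
def PropertyE {X : Type*} (S : MobiusStructure X) : Prop :=
  ∃ σ : Set X, IsPtolemyCircle S σ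

/-- Property (I): existence and uniqueness of space inversions. -/
def PropertyI {X : Type*} (S : MobiusStructure X) : Prop :=
  ∀ ω ω' : X, ω ≠ ω' → ∀ Sp : Set X, IsMetricSphere S ω ω' Sp →
    ∃! φ : X → X, IsSpaceInversion S ω ω' Sp φ

/-- The Möbius space is compact. -/
def MobiusCompact {X : Type*} (S : MobiusStructure X) : Prop :=
  letI : TopologicalSpace X := mobiusTop S
  CompactSpace X

/-- Property (H), the homothety property. -/
def PropertyH {X : Type*} (S : MobiusStructure X) : Prop :=
  ∀ ω ω' : X, ω ≠ ω' → ∀ σ : Set X, IsPtolemyCircle S σ → ω ∈ σ → ω' ∈ σ →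
    ∀ x x' : X, x ∈ σ \ {ω, ω'} → x' ∈ mobiusCCIn S (σ \ {ω, ω'}) x →
    ∃ γ : X → X, IsMobiusAuto S γ ∧ γ ω = ω ∧ γ ω' = ω' ∧
      (∀ σ' : Set X, IsPtolemyCircle S σ' → ω ∈ σ' → ω' ∈ σ' →
        γ '' σ' = σ' ∧ ∀ y ∈ σ' \ {ω, ω'}, γ y ∈ mobiusCCIn S (σ' \ {ω, ω'}) y) ∧
      γ x = x'

/-- A Ptolemy line in `X_ω`: a Ptolemy circle through `ω` with `ω` removed. -/
def IsPtolemyLine {X : Type*} (S : MobiusStructure X) (ω : X) (l : Set X) : Prop :=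
  ∃ σ : Set X, IsPtolemyCircle S σ ∧ ω ∈ σ ∧ l = σ \ {ω}

/-- `c : ℝ → X` is a unit-speed parameterization of `l ⊆ X` w.r.t. the metric `d`. -/
def IsUnitSpeed {X : Type*} (d : ExtMetric X) (l : Set X) (c : ℝ → X) : Prop :=
  Set.range c = l ∧ ∀ s t : ℝ, d.d (c s) (c t) = ENNReal.ofReal |s - t|

/-- `b` is a Busemann function of the Ptolemy line `l ⊆ X_ω`:  up to an additive constant,
`b x = lim_{t→∞} (d(x,c(t)) − t)` for a unit-speed parameterization `c` of `l`. -/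
def IsBusemannOf {X : Type*} (S : MobiusStructure X) (d : ExtMetric X) (ω : X)
    (l : Set X) (b : X → ℝ) : Prop :=
  IsPtolemyLine S ω l ∧ ∃ c : ℝ → X, IsUnitSpeed d l c ∧ ∃ C : ℝ, ∀ x : X, x ≠ ω →
    Filter.Tendsto (fun t => (d.d x (c t)).toReal - t) Filter.atTop (nhds (b x + C))

/-- The fiber through `x` of the canonical fibration `π_ω`: the set of points on which
every Busemann function of every Ptolemy line of `X_ω` takes the same value as at `x`. -/
def mobiusFiber {X : Type*} (S : MobiusStructure X) (d : ExtMetric X) (ω : X) (x : X) :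
    Set X :=
  {y | y ≠ ω ∧ ∀ (l : Set X) (b : X → ℝ), IsBusemannOf S d ω l b → b y = b x}

/-- The base `B_ω` of the canonical fibration: the set of all fibers. -/
def mobiusBase {X : Type*} (S : MobiusStructure X) (d : ExtMetric X) (ω : X) :
    Set (Set X) :=
  {F | ∃ x : X, x ≠ ω ∧ F = mobiusFiber S d ω x}

/-- The distance between two fibers. -/
noncomputable def fiberDist {X : Type*} (d : ExtMetric X) (F F' : Set X) : ℝ :=
  sInf {r : ℝ | ∃ x ∈ F, ∃ x' ∈ F', r = (d.d x x').toReal}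

/-- Two Möbius spaces are Möbius equivalent: there is a bijection between them
preserving all cross-ratio triples. -/
def MobiusEquiv {X Y : Type*} (S : MobiusStructure X) (S' : MobiusStructure Y) : Prop :=
  ∃ f : X → Y, Function.Bijective f ∧ ∀ d ∈ S.M, ∀ d' ∈ S'.M, ∀ x y z u : X,
    Admissible x y z u → ProjEq (crtVec d x y z u) (crtVec d' (f x) (f y) (f z) (f u))

/-- The standard extended Euclidean metric on the one-point extension
`ℝ̂ⁿ = ℝⁿ ∪ {∞}`, where `∞` is encoded by `none`. -/
noncomputable def stdExtMetric (n : ℕ) : ExtMetric (Option (EuclideanSpace ℝ (Fin n))) where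
  d x y :=
    match x, y with
    | none, none => 0
    | none, some _ => ⊤
    | some _, none => ⊤
    | some a, some b => ENNReal.ofReal (dist a b)
  rem := some none
  symm := by intro x y; cases x <;> cases y <;> simp [dist_comm]
  d_self := by intro x; cases x <;> simp
  pos := by
    intro x y h
    cases x <;> cases y
    · exact absurd rfl h
    · simp
    · simp
    · simp only [ne_eq, Option.some.injEq] at h
      exact ENNReal.ofReal_pos.mpr (dist_pos.mpr h)
  triangle := by
    intro x y z
    cases x <;> cases y <;> cases z <;>
      simp only [le_refl, le_top, zero_le, zero_add, add_zero, top_add, add_top,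
        top_le_iff]
    rw [← ENNReal.ofReal_add dist_nonneg dist_nonneg]
    exact ENNReal.ofReal_le_ofReal (dist_triangle _ _ _)
  d_eq_top_iff := by
    intro x y
    cases x <;> cases y <;>
      simp [ENNReal.ofReal_ne_top]


namespace ExtMetric

variable {X : Type*} (d : ExtMetric X)

theorem fd_self (x : X) : d.fd x x = 0 := by
  simp [fd, d.d_self]

theorem fd_comm (x y : X) : d.fd x y = d.fd y x := by
  simp only [fd, d.symm x y]

theorem fd_pos {x y : X} (h : x ≠ y) : 0 < d.fd x y := by
  unfold fd
  split_ifs with ht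
  · exact one_pos
  · exact ENNReal.toReal_pos (d.pos x y h).ne' ht

theorem fd_nonneg (x y : X) : 0 ≤ d.fd x y := by
  rcases eq_or_ne x y with rfl | h
  · exact (d.fd_self x).ge
  · exact (d.fd_pos h).le

theorem fd_rem {x u : X} (hu : d.rem = some u) (h : x ≠ u) : d.fd x u = 1 :=
  if_pos ((d.d_eq_top_iff x u).2 ⟨h, Or.inr hu⟩)

theorem fd_triangle {u x y z : X} (hu : d.rem = some u) (hx : x ≠ u) (hy : y ≠ u)
    (hz : z ≠ u) : d.fd x z ≤ d.fd x y + d.fd y z := by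
  have ht : ∀ {a b : X}, a ≠ u → b ≠ u → d.d a b ≠ ⊤ := fun {a b} ha hb h => by
    rcases (d.d_eq_top_iff a b).1 h with ⟨-, h | h⟩ <;>
      exact absurd (Option.some.inj (hu.symm.trans h)) (by simp [ha.symm, hb.symm])
  simp only [fd, if_neg (ht hx hz), if_neg (ht hx hy), if_neg (ht hy hz)]
  rw [← ENNReal.toReal_add (ht hx hy) (ht hy hz)]
  exact ENNReal.toReal_mono (ENNReal.add_ne_top.2 ⟨ht hx hy, ht hy hz⟩) (d.triangle x y z)

open Classical in
/-- The metric inversion with respect to `z` of an extended metric, with values as in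
`d(x,y) / (d(z,x) d(z,y))`; the triangle inequality is Ptolemy's inequality for the
quadruples containing `z`. -/
noncomputable def inversion (z : X)
    (hpt : ∀ x y v : X, x ≠ y → y ≠ v → x ≠ v → x ≠ z → y ≠ z → v ≠ z →
      d.fd x v * d.fd z y ≤ d.fd x y * d.fd z v + d.fd y v * d.fd z x) : ExtMetric X where
  d x y := if x = y then 0 else if x = z ∨ y = z then ⊤ else
    ENNReal.ofReal (d.fd x y / (d.fd z x * d.fd z y))
  rem := some z
  symm x y := by
    simp only [d.fd_comm x y, mul_comm (d.fd z x), eq_comm (a := x) (b := y),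
      or_comm (a := x = z)]
  d_self x := if_pos rfl
  pos x y h := by
    rw [if_neg h]
    split_ifs with hz
    · exact ENNReal.zero_lt_top
    · obtain ⟨hx, hy⟩ := not_or.1 hz
      exact ENNReal.ofReal_pos.2 (div_pos (d.fd_pos h)
        (mul_pos (d.fd_pos (Ne.symm hx)) (d.fd_pos (Ne.symm hy))))
  triangle x y v := by
    by_cases hxv : x = v
    · simp [hxv]
    by_cases hxy : x = y
    · simp [hxy]
    by_cases hyv : y = v
    · simp [hyv]
    by_cases hx : x = z
    · simp only [if_neg hxy, if_pos (show x = z ∨ y = z from .inl hx), top_add, le_top]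
    by_cases hy : y = z
    · simp only [if_neg hxy, if_pos (show x = z ∨ y = z from .inr hy), top_add, le_top]
    by_cases hv : v = z
    · simp only [if_neg hyv, if_pos (show y = z ∨ v = z from .inr hv), add_top, le_top]
    simp only [hxv, hxy, hyv, hx, hy, hv, or_self, if_false]
    have px := d.fd_pos (Ne.symm hx)
    have py := d.fd_pos (Ne.symm hy)
    have pv := d.fd_pos (Ne.symm hv)
    have nxy := d.fd_nonneg x y
    have nyv := d.fd_nonneg y v
    rw [← ENNReal.ofReal_add (by positivity) (by positivity)]
    apply ENNReal.ofReal_le_ofReal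
    calc d.fd x v / (d.fd z x * d.fd z v)
        = d.fd x v * d.fd z y / (d.fd z x * d.fd z y * d.fd z v) := by field_simp
      _ ≤ (d.fd x y * d.fd z v + d.fd y v * d.fd z x) / (d.fd z x * d.fd z y * d.fd z v) := by
          gcongr
          exact hpt x y v hxy hyv hxv hx hy hv
      _ = d.fd x y / (d.fd z x * d.fd z y) + d.fd y v / (d.fd z y * d.fd z v) := by
          field_simp
  d_eq_top_iff x y := by
    by_cases hxy : x = y
    · simp [hxy]
    · by_cases hz : x = z ∨ y = z
      · simp [hxy, hz, eq_comm (a := z)]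
      · simp [hxy, hz, eq_comm (a := z)]

/-- Inversion rescales finite factors conformally. -/
theorem exists_fd_inversion (z : X)
    (hpt : ∀ x y v : X, x ≠ y → y ≠ v → x ≠ v → x ≠ z → y ≠ z → v ≠ z →
      d.fd x v * d.fd z y ≤ d.fd x y * d.fd z v + d.fd y v * d.fd z x) :
    ∃ g : X → ℝ, (∀ x, 0 < g x) ∧
      ∀ x y, (d.inversion z hpt).fd x y = d.fd x y * (g x * g y) := by
  classical
  refine ⟨fun x => if x = z then 1 else (d.fd z x)⁻¹, fun x => ?_, fun x y => ?_⟩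
  · dsimp only
    split_ifs with h
    · exact one_pos
    · exact inv_pos.2 (d.fd_pos (Ne.symm h))
  · rcases eq_or_ne x y with rfl | hxy
    · simp [fd_self]
    by_cases hx : x = z
    · subst hx
      have := (d.fd_pos hxy).ne'
      rw [fd_comm, fd_rem _ rfl hxy.symm]
      simp [hxy.symm, this]
    by_cases hy : y = z
    · subst hy
      have := (d.fd_pos hxy).ne'
      rw [fd_rem _ rfl hxy]
      simp [hxy, d.fd_comm y x, this]
    have h0 : 0 ≤ d.fd x y / (d.fd z x * d.fd z y) :=
      div_nonneg (d.fd_nonneg _ _) (mul_nonneg (d.fd_nonneg _ _) (d.fd_nonneg _ _))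
    rw [fd]
    simp only [inversion, hxy, hx, hy, or_self, if_false, ENNReal.ofReal_ne_top,
      ENNReal.toReal_ofReal h0]
    rw [div_eq_mul_inv, mul_inv]

end ExtMetric

/-- Metrics whose finite factors differ by a conformal factor have the same cross-ratios. -/
theorem projEq_crtVec_of_conformal {X : Type*} {d d' : ExtMetric X} {g : X → ℝ}
    (hg : ∀ x, 0 < g x) (h : ∀ x y, d'.fd x y = d.fd x y * (g x * g y)) (x y z u : X) :
    ProjEq (crtVec d x y z u) (crtVec d' x y z u) := by
  have := hg x
  have := hg y
  have := hg z
  have := hg u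
  refine ⟨g x * g y * g z * g u, by positivity, ?_⟩
  simp only [crtVec, h, Prod.smul_mk, smul_eq_mul, Prod.mk.injEq]
  refine ⟨?_, ?_, ?_⟩ <;> ring

/-- The entries of a triple satisfy the triangle inequality. -/
def TriangleTriple (v : ℝ × ℝ × ℝ) : Prop :=
  v.1 ≤ v.2.1 + v.2.2 ∧ v.2.1 ≤ v.1 + v.2.2 ∧ v.2.2 ≤ v.1 + v.2.1

theorem TriangleTriple.of_projEq {v w : ℝ × ℝ × ℝ} (hv : TriangleTriple v)
    (h : ProjEq v w) : TriangleTriple w := by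
  obtain ⟨l, hl, rfl⟩ := h
  obtain ⟨h1, h2, h3⟩ := hv
  refine ⟨?_, ?_, ?_⟩ <;>
    simp only [Prod.smul_fst, Prod.smul_snd, smul_eq_mul, ← mul_add] <;>
    gcongr

theorem triangleTriple_crtVec {X : Type*} (d : ExtMetric X) {u : X} (hu : d.rem = some u)
    (x y z : X) : TriangleTriple (crtVec d x y z u) := by
  have nonneg := d.fd_nonneg
  by_cases hx : x = u
  · have := mul_nonneg (nonneg x y) (nonneg z x)
    subst hx
    simp only [TriangleTriple, crtVec, d.fd_self, d.fd_comm z x, d.fd_comm y x] at this ⊢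
    refine ⟨?_, ?_, ?_⟩ <;> linarith
  by_cases hy : y = u
  · have := mul_nonneg (nonneg x y) (nonneg y z)
    subst hy
    simp only [TriangleTriple, crtVec, d.fd_self, d.fd_comm z y] at this ⊢
    refine ⟨?_, ?_, ?_⟩ <;> linarith
  by_cases hz : z = u
  · have := mul_nonneg (nonneg x z) (nonneg y z)
    subst hz
    simp only [TriangleTriple, crtVec, d.fd_self] at this ⊢
    refine ⟨?_, ?_, ?_⟩ <;> linarith
  have h1 := d.fd_triangle hu hx hz hy
  have h2 := d.fd_triangle hu hx hy hz
  have h3 := d.fd_triangle hu hy hx hz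
  rw [d.fd_comm z y] at h1
  rw [d.fd_comm y x] at h3
  simp only [TriangleTriple, crtVec, d.fd_rem hu hx, d.fd_rem hu hy, d.fd_rem hu hz]
  refine ⟨?_, ?_, ?_⟩ <;> linarith

/-- Proposition 2.5 of the paper.  A Möbius structure `𝓜` on a set `X`
is Ptolemy if and only if for every `z ∈ X` there exists a metric `d_z ∈ 𝓜` whose
infinitely remote point is `z`. -/
theorem stmt_1 {X : Type*} (S : MobiusStructure X) :
    IsPtolemyStructure S ↔ ∀ z : X, ∃ d ∈ S.M, d.rem = some z := by
  refine ⟨fun hS z => ?_, fun h d hd x y z u ha => ?_⟩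
  · obtain ⟨d, hd⟩ := S.nonempty
    have hpt : ∀ x y v : X, x ≠ y → y ≠ v → x ≠ v → x ≠ z → y ≠ z → v ≠ z →
        d.fd x v * d.fd z y ≤ d.fd x y * d.fd z v + d.fd y v * d.fd z x := by
      intro x y v hxy hyv hxv hx hy hv
      have h := (hS d hd x y v z ⟨fun h => hxy h.1, fun h => hxy h.1, fun h => hxv h.1,
        fun h => hyv h.1⟩).2.1
      simp only [crtVec] at h
      rw [d.fd_comm z y, d.fd_comm z v, d.fd_comm z x]
      linarith
    obtain ⟨g, hg, hfd⟩ := d.exists_fd_inversion z hpt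
    exact ⟨d.inversion z hpt, S.maximal _ fun d' hd' x y v u ha =>
      (S.compat d hd d' hd' x y v u ha).trans' (projEq_crtVec_of_conformal hg hfd x y v u), rfl⟩
  · obtain ⟨d', hd', hu⟩ := h u
    exact (triangleTriple_crtVec d' hu x y z).of_projEq (S.compat d' hd' d hd x y z u ha)

end Mobius
end

section
/- Let (Y,d) be a Ptolemaic metric space, γ : ℝ → Y a geodesic line, ω' = γ(0), and x ∈ Y with x ≠ ω'. Define b⁺(x) = lim_{t→∞}(d(x,γ(t)) − t), b⁻(x) = lim_{t→∞}(d(x,γ(−t)) − t), and define f : ℝ → ℝ by f(0) = 1/d(x,ω') and f(t) = |t|·d(x,γ(1/t))/d(x,ω') for t ≠ 0 (f(t) is the distance from x to γ(1/t) in the metric inversion of d with respect to ω'). Then f is a convex function, the right and left derivatives of ln∘f at 0 exist, b⁺(x) equals the right derivative of ln∘f at 0, and b⁻(x) equals the negative of the left derivative of ln∘f at 0. -/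
/-- A metric space is Ptolemaic if the Ptolemy inequality holds for all quadruples. -/
def PtolemaicDist (Y : Type*) [MetricSpace Y] : Prop :=
  ∀ x y z u : Y, dist x z * dist y u ≤ dist x y * dist z u + dist x u * dist y z

theorem Isometry.abs_mul_abs_mul_dist_one_div {Y : Type*} [MetricSpace Y] {γ : ℝ → Y}
    (hγ : Isometry γ) {s t : ℝ} (hs : s ≠ 0) (ht : t ≠ 0) :
    |s| * |t| * dist (γ (1 / s)) (γ (1 / t)) = |t - s| := by
  rw [hγ.dist_eq, Real.dist_eq, ← abs_mul, ← abs_mul]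
  congr 1
  field_simp

/-- The distance from `x` to the points of a geodesic line, in the metric inversion based at a
point of that line, satisfies the three-point convexity inequality. -/
theorem PtolemaicDist.inversion_three_point {Y : Type*} [MetricSpace Y] (hpt : PtolemaicDist Y)
    {γ : ℝ → Y} (hγ : Isometry γ) {x : Y} {F : ℝ → ℝ} (hF0 : F 0 = 1)
    (hF : ∀ t : ℝ, t ≠ 0 → F t = |t| * dist x (γ (1 / t))) {s t u : ℝ}
    (hst : s < t) (htu : t < u) :
    F t * (u - s) ≤ F s * (u - t) + F u * (t - s) := by
  have dist_swap (p q : ℝ) (hp : p ≠ 0) (hq : q ≠ 0) :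
      |p| * |q| * dist x (γ (1 / q)) ≤ |p| * |q| * dist x (γ (1 / p)) + |q - p| := by
    rw [← hγ.abs_mul_abs_mul_dist_one_div hp hq, ← mul_add]
    gcongr
    exact dist_triangle _ _ _
  by_cases hs : s = 0
  · subst hs
    have hu : 0 < u := hst.trans htu
    have h := dist_swap u t hu.ne' hst.ne'
    rw [hF0, hF t hst.ne', hF u hu.ne']
    rw [abs_of_pos hst, abs_of_pos hu, abs_of_neg (sub_neg.2 htu)] at *
    linarith
  by_cases hu : u = 0
  · subst hu
    have h := dist_swap s t hs htu.ne
    rw [hF0, hF t htu.ne, hF s hs]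
    rw [abs_of_neg htu, abs_of_neg (hst.trans htu), abs_of_pos (sub_pos.2 hst)] at *
    linarith
  have hsu := hγ.abs_mul_abs_mul_dist_one_div hs hu
  rw [abs_of_pos (sub_pos.2 (hst.trans htu))] at hsu
  by_cases ht : t = 0
  · subst ht
    have h : dist (γ (1 / s)) (γ (1 / u)) ≤ dist x (γ (1 / s)) + dist x (γ (1 / u)) :=
      dist_triangle_left _ _ _
    have h' := mul_le_mul_of_nonneg_left h (by positivity : 0 ≤ |s| * |u|)
    rw [hsu] at h'
    rw [hF0, hF s hs, hF u hu]
    rw [abs_of_neg hst, abs_of_pos htu] at *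
    linarith
  have hst' := hγ.abs_mul_abs_mul_dist_one_div hs ht
  have htu' := hγ.abs_mul_abs_mul_dist_one_div ht hu
  rw [abs_of_pos (sub_pos.2 hst)] at hst'
  rw [abs_of_pos (sub_pos.2 htu)] at htu'
  have h := hpt x (γ (1 / s)) (γ (1 / t)) (γ (1 / u))
  have h' := mul_le_mul_of_nonneg_left h (by positivity : 0 ≤ |s| * |t| * |u|)
  rw [hF s hs, hF t ht, hF u hu, ← hsu, ← hst', ← htu']
  linarith

/-- duality between Busemann and distance functions, Proposition 3.1.
Let `(Y,d)` be a Ptolemaic metric space, `γ : ℝ → Y` a geodesic line, `ω' = γ 0`,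
`x ≠ ω'`, and let `f(0) = 1/d(x,ω')`, `f(t) = |t|·d(x,γ(1/t))/d(x,ω')` for `t ≠ 0`
(the distance from `x` to `γ(1/t)` in the metric inversion of `d` w.r.t. `ω'`).
Then `f` is convex, the one-sided derivatives of `ln ∘ f` at `0` exist, the Busemann
limit `b⁺(x)` equals the right derivative of `ln ∘ f` at `0`, and `b⁻(x)` equals the
negative of the left derivative of `ln ∘ f` at `0`. -/
theorem stmt_2 {Y : Type*} [MetricSpace Y] (hpt : PtolemaicDist Y)
    (γ : ℝ → Y) (hγ : Isometry γ) (x : Y) (hx : x ≠ γ 0)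
    (f : ℝ → ℝ) (hf0 : f 0 = 1 / dist x (γ 0))
    (hf : ∀ t : ℝ, t ≠ 0 → f t = |t| * dist x (γ (1 / t)) / dist x (γ 0)) :
    ConvexOn ℝ Set.univ f ∧
    ∃ bp bm : ℝ,
      Filter.Tendsto (fun t => dist x (γ t) - t) Filter.atTop (nhds bp) ∧
      Filter.Tendsto (fun t => dist x (γ (-t)) - t) Filter.atTop (nhds bm) ∧
      HasDerivWithinAt (fun t => Real.log (f t)) bp (Set.Ici 0) 0 ∧
      HasDerivWithinAt (fun t => Real.log (f t)) (-bm) (Set.Iic 0) 0 := by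
  have ha : 0 < dist x (γ 0) := dist_pos.2 hx
  have hfa0 : f 0 * dist x (γ 0) = 1 := by rw [hf0]; field_simp
  have hfa (t : ℝ) (ht : t ≠ 0) : f t * dist x (γ 0) = |t| * dist x (γ (1 / t)) := by
    rw [hf t ht]; field_simp
  have hconv : ConvexOn ℝ Set.univ f := by
    refine convexOn_of_slope_mono_adjacent convex_univ fun {s t u} _ _ hst htu => ?_
    have h := hpt.inversion_three_point hγ (F := fun t => f t * dist x (γ 0)) hfa0 hfa hst htu
    have h' : f t * (u - s) ≤ f s * (u - t) + f u * (t - s) :=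
      le_of_mul_le_mul_right (by linarith) ha
    rw [div_le_div_iff₀ (sub_pos.2 hst) (sub_pos.2 htu)]
    linarith
  have hr := hconv.hasDerivWithinAt_rightDeriv_of_mem_interior (x := 0) (by simp)
  have hl := hconv.hasDerivWithinAt_leftDeriv_of_mem_interior (x := 0) (by simp)
  set r := derivWithin f (Set.Ioi 0) 0
  set l := derivWithin f (Set.Iio 0) 0
  have hf0' : f 0 ≠ 0 := left_ne_zero_of_mul_eq_one hfa0
  refine ⟨hconv, r * dist x (γ 0), -(l * dist x (γ 0)), ?_, ?_, ?_, ?_⟩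
  · have h := ((hasDerivWithinAt_iff_tendsto_slope' (by simp)).1 hr).comp
      tendsto_inv_atTop_nhdsGT_zero
    refine (h.mul_const (dist x (γ 0))).congr' ?_
    filter_upwards [Filter.eventually_gt_atTop 0] with t ht
    have h1 := hfa t⁻¹ (inv_ne_zero ht.ne')
    rw [abs_of_pos (inv_pos.2 ht), one_div, inv_inv] at h1
    simp only [Function.comp_apply, slope_def_field, sub_zero, div_inv_eq_mul]
    rw [mul_right_comm, sub_mul, h1, hfa0]
    field_simp
  · have h := (((hasDerivWithinAt_iff_tendsto_slope' (by simp)).1 hl).comp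
      tendsto_inv_atBot_nhdsLT_zero).comp Filter.tendsto_neg_atTop_atBot
    refine (h.mul_const (dist x (γ 0))).neg.congr' ?_
    filter_upwards [Filter.eventually_gt_atTop 0] with t ht
    have h1 := hfa (-t)⁻¹ (inv_ne_zero (neg_ne_zero.2 ht.ne'))
    rw [abs_inv, abs_neg, abs_of_pos ht, one_div, inv_inv] at h1
    simp only [Function.comp_apply, slope_def_field, sub_zero, div_inv_eq_mul]
    rw [mul_right_comm, sub_mul, h1, hfa0]
    field_simp
  · convert (hasDerivWithinAt_Ioi_iff_Ici.1 hr).log hf0' using 1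
    rw [hf0, one_div, div_inv_eq_mul]
  · convert (hasDerivWithinAt_Iio_iff_Iic.1 hl).log hf0' using 1
    rw [hf0, one_div, div_inv_eq_mul, neg_neg]
end

section
/- Let (Y,d) be a Ptolemaic metric space and c, c' : ℝ → Y geodesic lines. Define b(x) = lim_{t→∞}(d(x,c(t)) − t) and b'(x) = lim_{t→∞}(d(x,c'(t)) − t). If there exists a sequence t_i → ∞ with d(c(t_i), c'(t_i))/t_i → 0, then b − b' is a constant function on Y; more precisely, b'(x) = b(x) + b'(c(0)) for all x ∈ Y, and b'(c(0)) + b(c'(0)) = 0. -/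
open Filter Topology in
/-- If two rays diverge sublinearly along a sequence in a Ptolemaic space, the difference of
their Busemann functions takes at `x` at most its value at `y`. -/
lemma PtolemaicDist.busemann_add_le {Y : Type*} [MetricSpace Y] (hpt : PtolemaicDist Y)
    {c c' : ℝ → Y} {b b' : Y → ℝ}
    (hb : ∀ x : Y, Tendsto (fun t => dist x (c t) - t) atTop (𝓝 (b x)))
    (hb' : ∀ x : Y, Tendsto (fun t => dist x (c' t) - t) atTop (𝓝 (b' x)))
    {ts : ℕ → ℝ} (hts : Tendsto ts atTop atTop)
    (hdiv : Tendsto (fun i => dist (c (ts i)) (c' (ts i)) / ts i) atTop (𝓝 0)) (x y : Y) :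
    b x + b' y ≤ b' x + b y := by
  have hinv : Tendsto (fun i => (ts i)⁻¹) atTop (𝓝 0) := tendsto_inv_atTop_zero.comp hts
  have hbx := (hb x).comp hts
  have hby := (hb y).comp hts
  have hbx' := (hb' x).comp hts
  have hby' := (hb' y).comp hts
  have hl := (hbx.add hby').add ((hbx.mul hby').mul hinv)
  have hr := ((hdiv.const_mul (dist x y)).add (hbx'.add hby)).add ((hbx'.mul hby).mul hinv)
  simp only [mul_zero, add_zero, zero_add] at hl hr
  refine le_of_tendsto_of_tendsto hl hr ?_
  filter_upwards [hts.eventually_gt_atTop 0] with i hi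
  have h := hpt x y (c (ts i)) (c' (ts i))
  simp only [Function.comp_apply]
  refine le_of_mul_le_mul_right ?_ hi
  field_simp
  linarith

/-- The Busemann function of a geodesic line vanishes at the base point of the line. -/
lemma Isometry.busemann_zero {Y : Type*} [MetricSpace Y] {c : ℝ → Y} (hc : Isometry c) {r : ℝ}
    (h : Filter.Tendsto (fun t => dist (c 0) (c t) - t) Filter.atTop (nhds r)) : r = 0 := by
  refine tendsto_nhds_unique h (tendsto_const_nhds.congr' ?_)
  filter_upwards [Filter.eventually_ge_atTop 0] with t ht
  simp [hc.dist_eq, abs_of_nonneg ht]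

/-- converse half of Lemma 4.7.  Let `(Y,d)` be a Ptolemaic metric
space, `c, c' : ℝ → Y` geodesic lines, and let `b`, `b'` be the associated Busemann
functions `b(x) = lim_{t→∞}(d(x,c(t)) − t)`, `b'(x) = lim_{t→∞}(d(x,c'(t)) − t)`.
If there is a sequence `t_i → ∞` with `d(c(t_i),c'(t_i))/t_i → 0`, then `b − b'` is
constant; more precisely `b'(x) = b(x) + b'(c(0))` for all `x`, and
`b'(c(0)) + b(c'(0)) = 0`. -/
theorem stmt_7 {Y : Type*} [MetricSpace Y] (hpt : PtolemaicDist Y)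
    (c c' : ℝ → Y) (hc : Isometry c) (hc' : Isometry c')
    (b b' : Y → ℝ)
    (hb : ∀ x : Y, Filter.Tendsto (fun t => dist x (c t) - t) Filter.atTop (nhds (b x)))
    (hb' : ∀ x : Y, Filter.Tendsto (fun t => dist x (c' t) - t) Filter.atTop (nhds (b' x)))
    (ts : ℕ → ℝ) (hts : Filter.Tendsto ts Filter.atTop Filter.atTop)
    (hdiv : Filter.Tendsto (fun i => dist (c (ts i)) (c' (ts i)) / ts i)
      Filter.atTop (nhds 0)) :
    (∀ x : Y, b' x = b x + b' (c 0)) ∧ b' (c 0) + b (c' 0) = 0 := by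
  have hcon (x y : Y) : b x + b' y = b' x + b y :=
    le_antisymm (hpt.busemann_add_le hb hb' hts hdiv x y)
      (by linarith [hpt.busemann_add_le hb hb' hts hdiv y x])
  have h0 := hc.busemann_zero (hb (c 0))
  have h0' := hc'.busemann_zero (hb' (c' 0))
  exact ⟨fun x => by linarith [hcon x (c 0)], by linarith [hcon (c 0) (c' 0)]⟩
end
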